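/- Let p and r be two permutations of {1,…,n} chosen independently and uniformly at random, and let D_n = Σ_{i=1}^n |p(i) − r(i)| be their footrule distance. Then the expected normalized SRD score of two random rankings tends to 2/3: E[D_n]/⌊n²/2⌋ → 2/3 as n → ∞. -/

import Mathlib

open Filter

/-- The Spearman footrule (SRD) distance between two permutations of `{1,…,n}`
(identified with `Fin n`): `D(σ,τ) = Σ_i |σ(i) − τ(i)|`. -/
def footrule {n : ℕ} (σ τ : Equiv.Perm (Fin n)) : ℤ :=
  ∑ i : Fin n, |((σ i : ℕ) : ℤ) - ((τ i : ℕ) : ℤ)|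

/-- The expected value of the footrule distance `D(p,r)` when `p` and `r` are two
permutations of `{1,…,n}` chosen independently and uniformly at random. -/
noncomputable def expFootrule (n : ℕ) : ℝ :=
  (∑ pr : Equiv.Perm (Fin n) × Equiv.Perm (Fin n), (footrule pr.1 pr.2 : ℝ)) /
    (Fintype.card (Equiv.Perm (Fin n) × Equiv.Perm (Fin n)) : ℝ)

/-- Averaging a function of `σ i` over all permutations `σ` gives the average of the function. -/
theorem card_mul_sum_perm_apply {α : Type*} [Fintype α] [DecidableEq α] (f : α → ℤ) (i : α) :
    (Fintype.card α : ℤ) * ∑ σ : Equiv.Perm α, f (σ i) =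
      (Fintype.card (Equiv.Perm α) : ℤ) * ∑ a, f a := by
  have hconst (j : α) : ∑ σ : Equiv.Perm α, f (σ j) = ∑ σ : Equiv.Perm α, f (σ i) :=
    Fintype.sum_equiv (Equiv.mulRight (Equiv.swap i j)) _ _ fun σ => by simp
  calc (Fintype.card α : ℤ) * ∑ σ : Equiv.Perm α, f (σ i)
      = ∑ j : α, ∑ σ : Equiv.Perm α, f (σ j) := by simp [hconst]
    _ = ∑ σ : Equiv.Perm α, ∑ j : α, f (σ j) := Finset.sum_comm
    _ = (Fintype.card (Equiv.Perm α) : ℤ) * ∑ a, f a := by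
      simp only [Equiv.sum_comp, Finset.sum_const, Finset.card_univ, nsmul_eq_mul]

theorem two_mul_sum_range_abs_sub (n : ℕ) :
    2 * ∑ b ∈ Finset.range n, |(n : ℤ) - b| = n * (n + 1) := by
  have h : ∑ b ∈ Finset.range n, |(n : ℤ) - b| = ∑ b ∈ Finset.range n, ((n : ℤ) - b) :=
    Finset.sum_congr rfl fun b hb => abs_of_nonneg (by have := Finset.mem_range.1 hb; lia)
  have hid (m : ℕ) : 2 * ∑ b ∈ Finset.range m, (b : ℤ) = m * (m - 1) := by
    induction m with
    | zero => simp
    | succ m ih => rw [Finset.sum_range_succ, mul_add, ih]; push_cast; ring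
  rw [h, Finset.sum_sub_distrib, mul_sub, hid]
  simp
  ring

theorem three_mul_sum_range_sum_range_abs_sub (n : ℕ) :
    3 * ∑ a ∈ Finset.range n, ∑ b ∈ Finset.range n, |(a : ℤ) - b| = (n : ℤ) ^ 3 - n := by
  induction n with
  | zero => simp
  | succ n ih =>
    have hsymm : ∑ a ∈ Finset.range n, |(a : ℤ) - n| = ∑ b ∈ Finset.range n, |(n : ℤ) - b| :=
      Finset.sum_congr rfl fun a _ => abs_sub_comm _ _
    have := two_mul_sum_range_abs_sub n
    simp only [Finset.sum_range_succ, Finset.sum_add_distrib, hsymm, sub_self, abs_zero]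
    push_cast
    linear_combination ih + 3 * this

theorem three_mul_sum_footrule_right {n : ℕ} (hn : n ≠ 0) (σ : Equiv.Perm (Fin n)) :
    3 * ∑ τ : Equiv.Perm (Fin n), footrule σ τ =
      (Fintype.card (Equiv.Perm (Fin n)) : ℤ) * ((n : ℤ) ^ 2 - 1) := by
  have hn' : (n : ℤ) ≠ 0 := by exact_mod_cast hn
  have hsum : 3 * ∑ a : Fin n, ∑ b : Fin n, |((a : ℕ) : ℤ) - ((b : ℕ) : ℤ)| = (n : ℤ) ^ 3 - n := by
    rw [← three_mul_sum_range_sum_range_abs_sub, Finset.sum_range]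
    simp only [Finset.sum_range]
  have key : (n : ℤ) * ∑ τ : Equiv.Perm (Fin n), footrule σ τ =
      (Fintype.card (Equiv.Perm (Fin n)) : ℤ) *
        ∑ a : Fin n, ∑ b : Fin n, |((a : ℕ) : ℤ) - ((b : ℕ) : ℤ)| := by
    unfold footrule
    rw [Finset.sum_comm, Finset.mul_sum,
      ← Equiv.sum_comp σ fun a : Fin n => ∑ b : Fin n, |((a : ℕ) : ℤ) - ((b : ℕ) : ℤ)|,
      Finset.mul_sum]
    refine Finset.sum_congr rfl fun i _ => ?_
    simpa only [Fintype.card_fin] using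
      card_mul_sum_perm_apply (fun b : Fin n => |((σ i : ℕ) : ℤ) - ((b : ℕ) : ℤ)|) i
  apply mul_left_cancel₀ hn'
  linear_combination 3 * key + (Fintype.card (Equiv.Perm (Fin n)) : ℤ) * hsum

theorem expFootrule_eq {n : ℕ} (hn : n ≠ 0) : expFootrule n = ((n : ℝ) ^ 2 - 1) / 3 := by
  have h : 3 * ∑ pr : Equiv.Perm (Fin n) × Equiv.Perm (Fin n), footrule pr.1 pr.2 =
      (Fintype.card (Equiv.Perm (Fin n)) : ℤ) ^ 2 * ((n : ℤ) ^ 2 - 1) := by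
    rw [Fintype.sum_prod_type, Finset.mul_sum]
    simp only [three_mul_sum_footrule_right hn, Finset.sum_const, Finset.card_univ, nsmul_eq_mul]
    ring
  have hR : 3 * ∑ pr : Equiv.Perm (Fin n) × Equiv.Perm (Fin n), (footrule pr.1 pr.2 : ℝ) =
      (Fintype.card (Equiv.Perm (Fin n)) : ℝ) ^ 2 * ((n : ℝ) ^ 2 - 1) := by
    exact_mod_cast h
  have hc : (Fintype.card (Equiv.Perm (Fin n)) : ℝ) ≠ 0 := by
    exact_mod_cast Fintype.card_ne_zero
  rw [expFootrule, Fintype.card_prod, Nat.cast_mul, div_eq_div_iff (mul_ne_zero hc hc) (by norm_num)]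
  linear_combination hR

/-- The expected normalized SRD score `E[D_n]/⌊n²/2⌋` of two independent uniformly random
rankings of size `n` tends to `2/3` as `n → ∞`. -/
theorem expected_normalized_srd_tendsto_two_thirds :
    Tendsto (fun n : ℕ => expFootrule n / ((n ^ 2 / 2 : ℕ) : ℝ)) atTop
      (nhds (2 / 3)) := by
  have hlow : Tendsto (fun n : ℕ => (2 / 3 : ℝ) - 1 / (n : ℝ)) atTop (nhds (2 / 3)) := by
    simpa using tendsto_const_nhds.sub (tendsto_one_div_atTop_nhds_zero_nat (𝕜 := ℝ))
  refine tendsto_of_tendsto_of_tendsto_of_le_of_le' hlow tendsto_const_nhds ?_ ?_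
  all_goals
    filter_upwards [eventually_ge_atTop 2] with n hn
    rw [expFootrule_eq (by lia)]
    have hm : n ≤ n ^ 2 / 2 := by
      rw [Nat.le_div_iff_mul_le two_pos]
      nlinarith
    have hl : 2 * (n ^ 2 / 2) ≤ n ^ 2 := by lia
    have hu : n ^ 2 ≤ 2 * (n ^ 2 / 2) + 1 := by lia
    generalize n ^ 2 / 2 = m at hm hl hu ⊢
    have hn0 : (0 : ℝ) < n := by exact_mod_cast (by lia : 0 < n)
    have hmR : (n : ℝ) ≤ m := by exact_mod_cast hm
    have hm0 : (0 : ℝ) < m := hn0.trans_le hmR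
    have hlR : 2 * (m : ℝ) ≤ (n : ℝ) ^ 2 := by exact_mod_cast hl
    have huR : (n : ℝ) ^ 2 ≤ 2 * m + 1 := by exact_mod_cast hu
  · rw [le_div_iff₀ hm0]
    have : 1 ≤ 1 / (n : ℝ) * m := by
      rw [one_div_mul_eq_div, le_div_iff₀ hn0]
      linarith
    linarith
  · rw [div_le_iff₀ hm0]
    linarith
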